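/- Shift-invariance forces triviality for Gaussian location families: if B ⊆ ℝ is a Borel set such that μ ↦ P(Z + μ ∈ B) is constant over μ ∈ ℝ, where Z ~ N(0, σ²) with σ > 0, then P(Z ∈ B) ∈ {0, 1} (equivalently, B has Lebesgue measure 0 or its complement has Lebesgue measure 0). -/

import Mathlib

open MeasureTheory ProbabilityTheory
open scoped NNReal ENNReal BigOperators

lemma gaussian_tilt (v : ℝ≥0) (hv : 0 < v) (t x : ℝ) :
    gaussianPDFReal 0 v x * Real.exp (t * x)
      = Real.exp (v * t ^ 2 / 2) * gaussianPDFReal (v * t) v x := by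
  have hv' : (v : ℝ) ≠ 0 := by exact_mod_cast hv.ne'
  simp only [gaussianPDFReal]
  rw [mul_assoc, ← Real.exp_add, mul_left_comm, ← Real.exp_add]
  congr 2
  field_simp
  ring

lemma mgf_restrict_gaussian (v : ℝ≥0) (hv : 0 < v) (B : Set ℝ) (hB : MeasurableSet B) (t : ℝ) :
    mgf id ((gaussianReal 0 v).restrict B) t
      = Real.exp (v * t ^ 2 / 2) * (gaussianReal (v * t) v B).toReal := by
  rw [mgf, ← integral_indicator hB, integral_gaussianReal_eq_integral_smul hv.ne',
    gaussianReal_apply_eq_integral _ hv.ne', ENNReal.toReal_ofReal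
      (integral_nonneg fun x => gaussianPDFReal_nonneg _ _ _), ← integral_const_mul,
    ← integral_indicator hB]
  congr 1
  ext x
  by_cases hx : x ∈ B
  · simp [hx, gaussian_tilt v hv]
  · simp [hx]

/-- Shift-invariance forces triviality for Gaussian location families: if the
probability `P(Z + μ ∈ B)` (i.e., `N(μ, σ²)(B)`) is constant in `μ`, then it is
`0` or `1`. -/
theorem gaussian_shift_invariant_trivial
    (v : ℝ≥0) (hv : 0 < v) (B : Set ℝ) (hB : MeasurableSet B)
    (hconst : ∀ μ : ℝ, gaussianReal μ v B = gaussianReal 0 v B) :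
    gaussianReal 0 v B = 0 ∨ gaussianReal 0 v B = 1 := by
  by_cases h0 : gaussianReal 0 v B = 0
  · exact Or.inl h0
  right
  set c := gaussianReal 0 v B with hc
  have hcfin : c ≠ ∞ := measure_ne_top _ _
  have : IsFiniteMeasure (c • gaussianReal 0 v) := Measure.smul_finite _ hcfin
  have hmgf : mgf id ((gaussianReal 0 v).restrict B) = mgf id (c • gaussianReal 0 v) := by
    ext t
    rw [mgf_restrict_gaussian v hv B hB, hconst, mgf_smul_measure, mgf_id_gaussianReal]
    simp [mul_comm]
  have hset : integrableExpSet id ((gaussianReal 0 v).restrict B) = Set.univ := by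
    ext t
    simp only [integrableExpSet, Set.mem_setOf_eq, Set.mem_univ, iff_true]
    exact (integrable_exp_mul_gaussianReal t).restrict
  have heq := eqOn_complexMGF_of_mgf' hmgf (by
    have hne : gaussianReal 0 v ≠ 0 := IsProbabilityMeasure.ne_zero _
    rw [Measure.restrict_eq_zero]
    refine ⟨fun h => absurd h h0, fun h => ?_⟩
    have := congrArg (fun m : Measure ℝ => m Set.univ) h
    simpa using this)
  rw [hset] at heq
  have hm : (gaussianReal 0 v).restrict B = c • gaussianReal 0 v :=
    Measure.ext_of_complexMGF_id_eq (funext fun z => heq (by simp))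
  have h1 := congrArg (fun m : Measure ℝ => m Bᶜ) hm
  simp [Measure.restrict_apply hB.compl, h0] at h1
  exact (prob_compl_eq_zero_iff hB).1 h1
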